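/- arXiv:2310.17713 — 2 statements merged into one kernel-verified Lean document; each statement's English description precedes it below -/
import Mathlib

section
/- Let $A$ be a non-empty finite subset of the non-negative rational numbers with $0 \in A$. Then there exists $k_0 \in \mathbb N$ such that for every integer $k \ge k_0$ one has $(k+1)A = kA + \{0, \max A\}$, where $kA$ denotes the $k$-fold setwise sum of $A$ with itself (and $0A = \{0\}$). -/
open scoped Pointwise

/-- The elements of `n • A` are the sums of the multisets of `n` elements of `A`. -/
theorem Finset.mem_nsmul_iff_exists_multiset {α : Type*} [AddCommMonoid α] [DecidableEq α]
    {A : Finset α} {n : ℕ} {x : α} :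
    x ∈ n • A ↔ ∃ s : Multiset α, s.card = n ∧ (∀ a ∈ s, a ∈ A) ∧ s.sum = x := by
  induction n generalizing x with
  | zero =>
    rw [zero_nsmul, Finset.mem_zero]
    constructor
    · rintro rfl
      exact ⟨0, by simp⟩
    · rintro ⟨s, hs, -, rfl⟩
      simp [Multiset.card_eq_zero.mp hs]
  | succ n ih =>
    rw [succ_nsmul, Finset.mem_add]
    constructor
    · rintro ⟨y, hy, a, ha, rfl⟩
      obtain ⟨s, hs, hsA, rfl⟩ := ih.mp hy
      refine ⟨a ::ₘ s, by simp [hs], ?_, by simp [add_comm]⟩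
      simpa [ha] using hsA
    · rintro ⟨s, hs, hsA, rfl⟩
      obtain ⟨a, t, rfl, ht⟩ := Multiset.card_eq_succ_iff.mp hs
      refine ⟨t.sum, ih.mpr ⟨t, ht, fun b hb => hsA b (by simp [hb]), rfl⟩,
        _, hsA _ (Multiset.mem_cons_self _ _), by simp [add_comm]⟩

/-- If `0 ∈ A`, then the sum of at most `n` elements of `A` lies in `n • A`. -/
theorem Finset.multiset_sum_mem_nsmul {α : Type*} [AddCommMonoid α] [DecidableEq α]
    {A : Finset α} (h0 : 0 ∈ A) {n : ℕ} {s : Multiset α} (hs : s.card ≤ n)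
    (hsA : ∀ a ∈ s, a ∈ A) : s.sum ∈ n • A :=
  Finset.nsmul_subset_nsmul_right h0 hs
    (Finset.mem_nsmul_iff_exists_multiset.mpr ⟨s, rfl, hsA, rfl⟩)

/-- A rational in `[0, M]` has a positive multiple `q • x = p • M` with `p ≤ q`. -/
theorem Rat.exists_nsmul_eq_nsmul_of_le {x M : ℚ} (hx : 0 ≤ x) (hxM : x ≤ M) :
    ∃ q p : ℕ, 0 < q ∧ p ≤ q ∧ q • x = p • M := by
  rcases (hx.trans hxM).eq_or_lt with rfl | hM
  · exact ⟨1, 0, one_pos, zero_le_one, by simp [le_antisymm hxM hx]⟩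
  · lift x / M to ℚ≥0 using div_nonneg hx hM.le with r hr
    have hrn : (r.num : ℚ) = r.den * (x / M) := by
      rw [← hr]
      exact_mod_cast (NNRat.den_mul_eq_num r).symm
    refine ⟨r.den, r.num, r.den_pos, ?_, ?_⟩
    · have h1 : x / M ≤ 1 := (div_le_one hM).mpr hxM
      have : (r.num : ℚ) ≤ r.den := by
        rw [hrn]
        exact mul_le_of_le_one_right (Nat.cast_nonneg _) h1
      exact_mod_cast this
    · rw [nsmul_eq_mul, nsmul_eq_mul, hrn]
      field_simp

/-- For a non-empty finite set `A` of non-negative rationals with `0 ∈ A`, for all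
sufficiently large `k` one has `(k+1)A = kA + {0, max A}`, where `kA` is the `k`-fold
setwise sum of `A` (with `0A = {0}`). -/
theorem succ_nsmul_eq_nsmul_add_pair (A : Finset ℚ) (h0 : (0 : ℚ) ∈ A)
    (hA : ∀ x ∈ A, 0 ≤ x) :
    ∃ k₀ : ℕ, ∀ k : ℕ, k₀ ≤ k →
      (k + 1) • A = k • A + ({0, A.max' ⟨0, h0⟩} : Finset ℚ) := by
  have hMA : A.max' ⟨0, h0⟩ ∈ A := A.max'_mem _
  have hle : ∀ x ∈ A, x ≤ A.max' ⟨0, h0⟩ := fun x hx => A.le_max' x hx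
  generalize A.max' ⟨0, h0⟩ = M at hMA hle
  choose! q p hq hpq hqp using fun x (hx : x ∈ A) =>
    Rat.exists_nsmul_eq_nsmul_of_le (hA x hx) (hle x hx)
  refine ⟨∑ x ∈ A, q x, fun k hk => Finset.Subset.antisymm (fun y hy => ?_) ?_⟩
  · obtain ⟨t, ht, htA, rfl⟩ := Finset.mem_nsmul_iff_exists_multiset.mp hy
    obtain ⟨x, hxA, hx⟩ : ∃ x ∈ A, q x ≤ t.count x := by
      by_contra! h
      have := Finset.sum_le_sum fun x hx => (h x hx).le
      rw [Multiset.sum_count_eq_card htA] at this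
      omega
    obtain ⟨u, rfl⟩ := Multiset.le_iff_exists_add.mp (Multiset.le_count_iff_replicate_le.mp hx)
    have huA : ∀ a ∈ u, a ∈ A := fun a ha => htA a (Multiset.mem_add.mpr (Or.inr ha))
    have hcard : q x + u.card = k + 1 := by simpa using ht
    have hqx := hq x hxA
    have hpx := hpq x hxA
    rw [Multiset.sum_add, Multiset.sum_replicate, hqp x hxA, Finset.mem_add]
    rcases hp : p x with _ | m
    · exact ⟨u.sum, Finset.multiset_sum_mem_nsmul h0 (by omega) huA, 0, by simp, by simp⟩
    · refine ⟨(Multiset.replicate m M + u).sum, Finset.multiset_sum_mem_nsmul h0 ?_ ?_,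
        M, by simp, ?_⟩
      · rw [Multiset.card_add, Multiset.card_replicate]
        omega
      · intro a ha
        rcases Multiset.mem_add.mp ha with ha | ha
        · exact Multiset.eq_of_mem_replicate ha ▸ hMA
        · exact huA a ha
      · rw [Multiset.sum_add, Multiset.sum_replicate, succ_nsmul, add_right_comm]
  · rw [succ_nsmul]
    exact Finset.add_subset_add_left (by simp [Finset.insert_subset_iff, h0, hMA])
end

section
/- Let $S_1$ and $S_2$ be Puiseux monoids, $\phi \colon \mathcal P_{\mathrm{fin},0}(S_1) \to \mathcal P_{\mathrm{fin},0}(S_2)$ a monoid isomorphism, and $a_1, a_2 \in S_1$. Then there exist $b_1, b_2 \in S_2$ with $\phi(\{0, a_1\}) = \{0, b_1\}$ and $\phi(\{0, a_2\}) = \{0, b_2\}$, and moreover $\phi(\{0, a_1 + a_2\}) = \{0, b_1 + b_2\}$. -/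
open scoped Pointwise NNRat

/-- The reduced finitary power monoid of an additive monoid `M`: the finite subsets of `M`
containing `0`, under setwise addition, viewed as an additive submonoid of `Finset M`. -/
def RFPM (M : Type*) [AddCommMonoid M] [DecidableEq M] : AddSubmonoid (Finset M) where
  carrier := {X | (0 : M) ∈ X}
  zero_mem' := Finset.zero_mem_zero
  add_mem' := fun h1 h2 => by simpa using Finset.add_mem_add h1 h2

theorem mem_RFPM {M : Type*} [AddCommMonoid M] [DecidableEq M] {X : Finset M}
    (h : (0 : M) ∈ X) : X ∈ RFPM M := h

namespace RFPM

variable {S : AddSubmonoid ℚ≥0}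

/-- The set `{0, a}` as an element of the reduced finitary power monoid. -/
def pair (a : S) : RFPM S :=
  ⟨{0, a}, mem_RFPM (Finset.mem_insert_self 0 {a})⟩

/-- The largest element of a finite set containing `0`. -/
def top (B : RFPM S) : S :=
  B.1.max' ⟨0, B.2⟩

theorem top_mem (B : RFPM S) : top B ∈ B.1 :=
  Finset.max'_mem _ _

theorem le_top {B : RFPM S} {x : S} (hx : x ∈ B.1) : x ≤ top B :=
  Finset.le_max' _ _ hx

theorem mem_pair {a x : S} : x ∈ (pair a).1 ↔ x = 0 ∨ x = a := by
  simp [pair]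

theorem mem_add {A B : RFPM S} {x : S} :
    x ∈ (A + B).1 ↔ ∃ y ∈ A.1, ∃ z ∈ B.1, y + z = x :=
  Finset.mem_add

theorem top_eq {B : RFPM S} {m : S} (hm : m ∈ B.1) (h : ∀ x ∈ B.1, x ≤ m) : top B = m :=
  le_antisymm (h _ (top_mem B)) (le_top hm)

theorem top_pair (a : S) : top (pair a) = a := by
  refine top_eq (mem_pair.2 (Or.inr rfl)) fun x hx => ?_
  rcases mem_pair.1 hx with rfl | rfl
  · exact zero_le (a := (a : ℚ≥0))
  · exact le_rfl

theorem top_add (A B : RFPM S) : top (A + B) = top A + top B := by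
  refine top_eq (mem_add.2 ⟨_, top_mem A, _, top_mem B, rfl⟩) fun x hx => ?_
  obtain ⟨y, hy, z, hz, rfl⟩ := mem_add.1 hx
  exact add_le_add (le_top hy) (le_top hz)

theorem mem_nsmul {B : RFPM S} {n : ℕ} {x : S} :
    x ∈ (n • B).1 ↔ ∃ s : Multiset S, s.card ≤ n ∧ (∀ y ∈ s, y ∈ B.1) ∧ s.sum = x := by
  induction n generalizing x with
  | zero =>
    rw [zero_nsmul]
    change x ∈ (0 : Finset S) ↔ _
    rw [Finset.mem_zero]
    constructor
    · rintro rfl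
      exact ⟨0, by simp⟩
    · rintro ⟨s, hs, -, rfl⟩
      rw [Multiset.card_eq_zero.1 (Nat.le_zero.1 hs), Multiset.sum_zero]
  | succ n ih =>
    rw [succ_nsmul, mem_add]
    constructor
    · rintro ⟨y, hy, z, hz, rfl⟩
      obtain ⟨s, hs, hB, rfl⟩ := ih.1 hy
      refine ⟨z ::ₘ s, by simpa using hs, ?_, by rw [Multiset.sum_cons, add_comm]⟩
      simpa [hz] using hB
    · rintro ⟨s, hs, hB, rfl⟩
      rcases s.empty_or_exists_mem with rfl | ⟨z, hz⟩
      · exact ⟨0, ih.2 ⟨0, by simp⟩, 0, B.2, by simp⟩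
      · obtain ⟨t, rfl⟩ := Multiset.exists_cons_of_mem hz
        refine ⟨t.sum, ih.2 ⟨t, by simpa using hs, fun y hy => hB y (by simp [hy]), rfl⟩,
          z, hB z hz, ?_⟩
        rw [Multiset.sum_cons, add_comm]

/-- Elements of a Puiseux monoid are commensurable. -/
theorem exists_nsmul_eq_nsmul {y m : S} (h : y ≤ m) :
    ∃ n p : ℕ, 0 < n ∧ p ≤ n ∧ n • y = p • m := by
  rcases eq_or_ne m 0 with rfl | hm
  · exact ⟨1, 0, one_pos, zero_le_one,
      by simpa using le_antisymm h (zero_le (a := (y : ℚ≥0)))⟩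
  have hm' : (0 : ℚ≥0) < m := pos_iff_ne_zero.2 fun h0 => hm (Subtype.ext h0)
  have heq : (((m : ℚ≥0).num * (y : ℚ≥0).den : ℕ) : ℚ≥0) * y =
      (((y : ℚ≥0).num * (m : ℚ≥0).den : ℕ) : ℚ≥0) * m := by
    push_cast
    rw [mul_assoc, mul_assoc, NNRat.den_mul_eq_num, NNRat.den_mul_eq_num, mul_comm]
  refine ⟨(m : ℚ≥0).num * (y : ℚ≥0).den, (y : ℚ≥0).num * (m : ℚ≥0).den,
    Nat.mul_pos (NNRat.num_pos.2 hm') (y : ℚ≥0).den_pos, ?_, ?_⟩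
  · have hle : (y : ℚ≥0) ≤ m := h
    have := heq.symm.le.trans (mul_le_mul_of_nonneg_left hle (by positivity))
    exact_mod_cast le_of_mul_le_mul_right this hm'
  · apply Subtype.ext
    simpa only [AddSubmonoidClass.coe_nsmul, nsmul_eq_mul] using heq

/-- Large multiples of `B` grow only by adding the largest element of `B`. -/
theorem exists_succ_nsmul_eq (B : RFPM S) :
    ∃ k : ℕ, (k + 1) • B = k • B + pair (top B) := by
  have hex : ∀ y : S, ∃ n p : ℕ, y ∈ B.1 → 0 < n ∧ p ≤ n ∧ n • y = p • top B := fun y => by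
    by_cases hy : y ∈ B.1
    · obtain ⟨n, p, h⟩ := exists_nsmul_eq_nsmul (le_top hy)
      exact ⟨n, p, fun _ => h⟩
    · exact ⟨0, 0, fun h => absurd h hy⟩
  choose n p hnp using hex
  refine ⟨∑ y ∈ B.1, n y, Subtype.ext (Finset.ext fun x => ?_)⟩
  set k := ∑ y ∈ B.1, n y with hk
  rw [mem_add]
  constructor
  · intro hx
    obtain ⟨s, hs, hB, rfl⟩ := mem_nsmul.1 hx
    have small : ∀ t : Multiset S, t.card ≤ k → (∀ y ∈ t, y ∈ B.1) →
        ∃ y ∈ (k • B).1, ∃ z ∈ (pair (top B)).1, y + z = t.sum := fun t ht htB =>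
      ⟨t.sum, mem_nsmul.2 ⟨t, ht, htB, rfl⟩, 0, (pair _).2, add_zero _⟩
    rcases Nat.lt_or_ge k s.card with hlt | hle
    swap
    · exact small s hle hB
    obtain ⟨y, hy, hcount⟩ : ∃ y ∈ B.1, n y < s.count y := by
      apply Finset.exists_lt_of_sum_lt
      rwa [Multiset.sum_count_eq_card hB]
    obtain ⟨hn, hpn, heq⟩ := hnp y hy
    obtain ⟨t, rfl⟩ := Multiset.le_iff_exists_add.1 (Multiset.le_count_iff_replicate_le.1 hcount.le)
    rw [Multiset.card_add, Multiset.card_replicate] at hs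
    have htB : ∀ z ∈ t, z ∈ B.1 := fun z hz => hB z (Multiset.mem_add.2 (Or.inr hz))
    rw [Multiset.sum_add, Multiset.sum_replicate, heq]
    rcases Nat.eq_zero_or_pos (p y) with hp | hp
    · rw [hp, zero_nsmul, zero_add]
      exact small t (by omega) htB
    · obtain ⟨q, hq⟩ := Nat.exists_eq_add_of_lt hp
      rw [zero_add] at hq
      refine ⟨(Multiset.replicate q (top B) + t).sum, mem_nsmul.2 ⟨_, ?_, ?_, rfl⟩, top B,
        mem_pair.2 (Or.inr rfl), ?_⟩
      · rw [Multiset.card_add, Multiset.card_replicate]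
        omega
      · intro z hz
        rcases Multiset.mem_add.1 hz with hz | hz
        · rw [Multiset.eq_of_mem_replicate hz]
          exact top_mem B
        · exact htB z hz
      · rw [Multiset.sum_add, Multiset.sum_replicate, hq, succ_nsmul, add_right_comm]
  · rintro ⟨y, hy, z, hz, rfl⟩
    rw [succ_nsmul, mem_add]
    refine ⟨y, hy, z, ?_, rfl⟩
    rcases mem_pair.1 hz with rfl | rfl
    · exact B.2
    · exact top_mem B

theorem top_eq_of_succ_nsmul_eq {B C : RFPM S} {k : ℕ} (h : (k + 1) • B = k • B + C) :
    top C = top B := by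
  have := congrArg top h
  rw [succ_nsmul, top_add, top_add] at this
  exact (add_left_cancel this).symm

theorem eq_pair_of_succ_nsmul_eq {a : S} {C : RFPM S} {k : ℕ}
    (h : (k + 1) • pair a = k • pair a + C) : C = pair a := by
  have htop : top C = a := (top_eq_of_succ_nsmul_eq h).trans (top_pair a)
  refine Subtype.ext (Finset.ext fun c => ?_)
  rw [mem_pair]
  constructor
  · intro hc
    have hmem : c ∈ ((k + 1) • pair a).1 := by
      rw [h]
      exact mem_add.2 ⟨0, (k • pair a).2, c, hc, zero_add c⟩
    obtain ⟨s, -, hs, rfl⟩ := mem_nsmul.1 hmem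
    by_cases ha : a ∈ s
    · obtain ⟨t, rfl⟩ := Multiset.exists_cons_of_mem ha
      rw [Multiset.sum_cons] at hc ⊢
      exact Or.inr (le_antisymm ((le_top hc).trans_eq htop)
        (le_add_of_nonneg_right (zero_le (a := (t.sum : ℚ≥0)))))
    · exact Or.inl (Multiset.sum_eq_zero fun y hy =>
        (mem_pair.1 (hs y hy)).resolve_right fun hya => ha (hya ▸ hy))
  · rintro (rfl | rfl)
    · exact C.2
    · exact htop ▸ top_mem C

variable {T : AddSubmonoid ℚ≥0}

theorem map_pair (φ : RFPM S ≃+ RFPM T) (a : S) :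
    φ (pair a) = pair (top (φ (pair a))) := by
  obtain ⟨k, hk⟩ := exists_succ_nsmul_eq (φ (pair a))
  have h := congrArg φ.symm hk
  rw [map_add, map_nsmul, map_nsmul, φ.symm_apply_apply] at h
  exact (φ.symm_apply_eq.1 (eq_pair_of_succ_nsmul_eq h)).symm

theorem map_pair_top (φ : RFPM S ≃+ RFPM T) (B : RFPM S) :
    φ (pair (top B)) = pair (top (φ B)) := by
  obtain ⟨k, hk⟩ := exists_succ_nsmul_eq B
  have h := congrArg φ hk
  rw [map_add, map_nsmul, map_nsmul] at h
  rw [map_pair, top_eq_of_succ_nsmul_eq h]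

end RFPM

/-- Given an isomorphism `φ` between the reduced finitary power monoids of two Puiseux
monoids and `a₁, a₂ ∈ S₁`, there are `b₁, b₂ ∈ S₂` with `φ {0, aᵢ} = {0, bᵢ}` for `i = 1, 2`,
and moreover `φ {0, a₁ + a₂} = {0, b₁ + b₂}`. -/
theorem iso_pair_add (S₁ S₂ : AddSubmonoid ℚ≥0)
    (φ : ↥(RFPM ↥S₁) ≃+ ↥(RFPM ↥S₂)) (a₁ a₂ : ↥S₁) :
    ∃ b₁ b₂ : ↥S₂,
      ((φ ⟨({0, a₁} : Finset ↥S₁), mem_RFPM (Finset.mem_insert_self 0 {a₁})⟩ :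
        ↥(RFPM ↥S₂)) : Finset ↥S₂) = {0, b₁} ∧
      ((φ ⟨({0, a₂} : Finset ↥S₁), mem_RFPM (Finset.mem_insert_self 0 {a₂})⟩ :
        ↥(RFPM ↥S₂)) : Finset ↥S₂) = {0, b₂} ∧
      ((φ ⟨({0, a₁ + a₂} : Finset ↥S₁), mem_RFPM (Finset.mem_insert_self 0 {a₁ + a₂})⟩ :
        ↥(RFPM ↥S₂)) : Finset ↥S₂) = {0, b₁ + b₂} := by
  have hsum := RFPM.map_pair_top φ (RFPM.pair a₁ + RFPM.pair a₂)
  rw [map_add, RFPM.top_add, RFPM.top_add, RFPM.top_pair, RFPM.top_pair] at hsum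
  exact ⟨_, _, congrArg Subtype.val (RFPM.map_pair φ a₁),
    congrArg Subtype.val (RFPM.map_pair φ a₂), congrArg Subtype.val hsum⟩
end
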